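/- For every bounded derivation D from the disc algebra A(𝔻) to its dual A(𝔻)*, there exists a finite positive Borel measure μ on the closed unit disc Δ such that ‖D(f)‖_{A(𝔻)*} ≤ (∫_Δ |f(z)|² dμ(z))^{1/2} for all f ∈ A(𝔻). -/

import Mathlib

open Complex MeasureTheory Metric Real

set_option synthInstance.maxHeartbeats 400000
set_option maxHeartbeats 1000000

noncomputable section

/-- The closed unit disc `Δ ⊆ ℂ`. -/
abbrev closedDisc : Set ℂ := Metric.closedBall 0 1

instance : CompactSpace closedDisc := isCompact_iff_compactSpace.mp (isCompact_closedBall 0 1)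

/-- The disc algebra `A(𝔻)`: continuous functions on the closed unit disc which are
holomorphic on the open unit disc, viewed as a closed subalgebra of `C(Δ, ℂ)` with the
supremum norm. -/
def discAlgebra : Subalgebra ℂ C(closedDisc, ℂ) where
  carrier := {f | ∃ F : ℂ → ℂ, DifferentiableOn ℂ F (Metric.ball 0 1) ∧ ∀ z : closedDisc, f z = F z}
  mul_mem' := by
    rintro f g ⟨F, hF, hf⟩ ⟨G, hG, hg⟩
    exact ⟨F * G, hF.mul hG, fun z => by simp [hf z, hg z]⟩
  one_mem' := ⟨fun _ => 1, differentiableOn_const 1, fun z => rfl⟩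
  add_mem' := by
    rintro f g ⟨F, hF, hf⟩ ⟨G, hG, hg⟩
    exact ⟨F + G, hF.add hG, fun z => by simp [hf z, hg z]⟩
  zero_mem' := ⟨fun _ => 0, differentiableOn_const 0, fun z => rfl⟩
  algebraMap_mem' := fun c => ⟨fun _ => c, differentiableOn_const c, fun z => rfl⟩

instance : NormedRing ↥discAlgebra := inferInstance
instance : NormedAlgebra ℂ ↥discAlgebra := inferInstance
instance : NormedSpace ℂ ↥discAlgebra := (inferInstance : NormedAlgebra ℂ ↥discAlgebra).toNormedSpace

/-- The dual space `A(𝔻)*` of the disc algebra. -/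
abbrev DADual := ↥discAlgebra →L[ℂ] ℂ

/-- `D : A(𝔻) → A(𝔻)*` is a derivation into the dual bimodule `A(𝔻)*`, where the
bimodule actions are `(f·φ)(u) = φ(fu) = (φ·f)(u)`: the derivation identity
`D(fg) = f·D(g) + g·D(f)` reads `D(fg)(u) = D(g)(fu) + D(f)(gu)`. -/
def IsDerivation (D : ↥discAlgebra →L[ℂ] DADual) : Prop :=
  ∀ f g u : ↥discAlgebra, D (f * g) u = D g (f * u) + D f (g * u)

open Polynomial Filter Topology

/-- Lebesgue measure on `[0, 1]`. -/
def unitMeasure : Measure ℝ := volume.restrict (Set.Icc 0 1)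

instance : IsProbabilityMeasure unitMeasure := ⟨by simp [unitMeasure]⟩

/-- Lebesgue measure on `[0, 1] × [0, 1]`. -/
def squareMeasure : Measure (ℝ × ℝ) := unitMeasure.prod unitMeasure

instance : IsProbabilityMeasure squareMeasure := by unfold squareMeasure; infer_instance

theorem Continuous.integrable_unitMeasure {E : Type*} [NormedAddCommGroup E] {F : ℝ → E}
    (hF : Continuous F) : Integrable F unitMeasure :=
  hF.integrableOn_Icc

theorem Continuous.integrable_squareMeasure {E : Type*} [NormedAddCommGroup E] {F : ℝ × ℝ → E}
    (hF : Continuous F) : Integrable F squareMeasure := by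
  unfold squareMeasure unitMeasure
  rw [Measure.prod_restrict]
  exact hF.continuousOn.integrableOn_compact (isCompact_Icc.prod isCompact_Icc)

theorem ae_unitMeasure_mem : ∀ᵐ r ∂unitMeasure, r ∈ Set.Icc (0 : ℝ) 1 :=
  ae_restrict_mem measurableSet_Icc

theorem ae_squareMeasure_fst_mem : ∀ᵐ p ∂squareMeasure, p.1 ∈ Set.Icc (0 : ℝ) 1 :=
  Measure.quasiMeasurePreserving_fst.ae ae_unitMeasure_mem

/-- The point `exp (2πiθ)` of the unit circle. -/
def circlePoint (θ : ℝ) : ℂ := Complex.exp (2 * π * θ * I)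

@[fun_prop]
theorem continuous_circlePoint : Continuous circlePoint := by unfold circlePoint; fun_prop

@[simp]
theorem norm_circlePoint (θ : ℝ) : ‖circlePoint θ‖ = 1 := by
  have : circlePoint θ = Complex.exp ((2 * π * θ : ℝ) * I) := by simp [circlePoint]
  rw [this, Complex.norm_exp_ofReal_mul_I]

theorem circlePoint_mul_conj (θ : ℝ) :
    circlePoint θ * (starRingEnd ℂ) (circlePoint θ) = 1 := by
  rw [Complex.mul_conj, Complex.normSq_eq_norm_sq]; simp

theorem exists_circlePoint_eq {z : ℂ} (hz : ‖z‖ = 1) : ∃ θ, circlePoint θ = z := by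
  obtain ⟨t, rfl⟩ := (Complex.norm_eq_one_iff z).mp hz
  refine ⟨t / (2 * π), ?_⟩
  unfold circlePoint
  congr 1
  push_cast
  have : (π : ℂ) ≠ 0 := by exact_mod_cast Real.pi_ne_zero
  field_simp

theorem integral_circlePoint_pow_mul_conj_pow (n m : ℕ) :
    ∫ θ, circlePoint θ ^ n * (starRingEnd ℂ) (circlePoint θ) ^ m ∂unitMeasure =
      if n = m then 1 else 0 := by
  split_ifs with h
  · subst h
    simp [← mul_pow, circlePoint_mul_conj]
  · have key : ∀ θ : ℝ, circlePoint θ ^ n * (starRingEnd ℂ) (circlePoint θ) ^ m =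
        Complex.exp ((2 * π * I * (n - m)) * θ) := by
      intro θ
      unfold circlePoint
      rw [← Complex.exp_conj, ← Complex.exp_nat_mul, ← Complex.exp_nat_mul, ← Complex.exp_add]
      congr 1
      simp only [map_mul, conj_ofReal, conj_I, map_ofNat]
      ring
    simp_rw [key]
    unfold unitMeasure
    rw [integral_Icc_eq_integral_Ioc, ← intervalIntegral.integral_of_le zero_le_one,
      integral_exp_mul_complex]
    · have : Complex.exp (2 * π * I * (n - m) * (1 : ℝ)) = 1 := by
        rw [Complex.exp_eq_one_iff]
        exact ⟨n - m, by push_cast; ring⟩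
      rw [this]; simp
    · have : (n : ℂ) - m ≠ 0 := sub_ne_zero.mpr (by exact_mod_cast h)
      simp [this, Real.pi_ne_zero]

/-- The density `-4 r log r` of the Littlewood-Paley measure in polar coordinates. -/
def radialWeight (r : ℝ) : ℝ := -4 * (r * Real.log r)

@[fun_prop]
theorem continuous_radialWeight : Continuous radialWeight := by
  unfold radialWeight
  exact continuous_const.mul Real.continuous_mul_log

theorem radialWeight_nonneg {r : ℝ} (hr : r ∈ Set.Icc (0 : ℝ) 1) : 0 ≤ radialWeight r := by
  have := Real.mul_log_nonpos hr.1 hr.2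
  unfold radialWeight; linarith

theorem integral_radialWeight_mul_pow (n : ℕ) :
    ∫ r, radialWeight r * r ^ (2 * n) ∂unitMeasure = 1 / ((n : ℝ) + 1) ^ 2 := by
  unfold unitMeasure
  rw [integral_Icc_eq_integral_Ioc, ← intervalIntegral.integral_of_le zero_le_one]
  have hc : Continuous fun r : ℝ => radialWeight r * r ^ (2 * n) := by fun_prop
  rw [intervalIntegral.integral_eq_sub_of_hasDerivAt_of_le zero_le_one
    (f := fun r : ℝ => (-2 / ((n : ℝ) + 1)) * (r ^ (2 * n + 1) * (r * Real.log r)) +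
      r ^ (2 * n + 2) / ((n : ℝ) + 1) ^ 2)
    (f' := fun r => radialWeight r * r ^ (2 * n)) _ _ (hc.intervalIntegrable _ _)]
  · simp
  · have := Real.continuous_mul_log
    exact Continuous.continuousOn (by fun_prop)
  · intro r hr
    have hr0 : r ≠ 0 := hr.1.ne'
    have h1 := (((hasDerivAt_pow (2 * n + 1) r).mul (Real.hasDerivAt_mul_log hr0)).const_mul
      (-2 / ((n : ℝ) + 1))).add ((hasDerivAt_pow (2 * n + 2) r).div_const (((n : ℝ) + 1) ^ 2))
    refine HasDerivAt.congr_deriv h1 ?_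
    unfold radialWeight
    have : (n : ℝ) + 1 ≠ 0 := by positivity
    simp only [Nat.add_sub_cancel, show 2 * n + 2 - 1 = 2 * n + 1 by omega]
    push_cast
    field_simp
    ring

/-- The point of the unit disc with polar coordinates `(r, 2πθ)`. -/
def polarPoint (p : ℝ × ℝ) : ℂ := p.1 * circlePoint p.2

@[fun_prop]
theorem continuous_polarPoint : Continuous polarPoint := by unfold polarPoint; fun_prop

theorem norm_polarPoint_le {p : ℝ × ℝ} (hp : p.1 ∈ Set.Icc (0 : ℝ) 1) : ‖polarPoint p‖ ≤ 1 := by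
  simp [polarPoint, abs_of_nonneg hp.1, hp.2]

/-- Littlewood-Paley identity, polarised. -/
theorem integral_derivative_mul_conj_derivative (u v : ℂ[X]) :
    ∫ p, (radialWeight p.1 : ℂ) * ((derivative u).eval (polarPoint p) *
        (starRingEnd ℂ) ((derivative v).eval (polarPoint p))) ∂squareMeasure =
      ∫ θ, u.eval (circlePoint θ) * (starRingEnd ℂ) (v.eval (circlePoint θ)) ∂unitMeasure -
        u.eval 0 * (starRingEnd ℂ) (v.eval 0) := by
  induction u using Polynomial.induction_on' with
  | add u₁ u₂ h₁ h₂ =>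
    simp only [derivative_add, eval_add, add_mul, mul_add]
    rw [integral_add, integral_add, h₁, h₂]
    · ring
    all_goals first
      | exact Continuous.integrable_unitMeasure (by fun_prop)
      | exact Continuous.integrable_squareMeasure (by fun_prop)
  | monomial n a =>
    induction v using Polynomial.induction_on' with
    | add v₁ v₂ h₁ h₂ =>
      simp only [eval_add, map_add, mul_add]
      rw [integral_add, integral_add, h₁, h₂]
      · ring
      all_goals first
        | exact Continuous.integrable_unitMeasure (by fun_prop)
        | exact Continuous.integrable_squareMeasure (by fun_prop)
    | monomial m b =>
      have hR : ∫ θ, (monomial n a).eval (circlePoint θ) *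
          (starRingEnd ℂ) ((monomial m b).eval (circlePoint θ)) ∂unitMeasure =
          a * (starRingEnd ℂ) b * if n = m then 1 else 0 := by
        rw [← integral_circlePoint_pow_mul_conj_pow, ← integral_const_mul]
        congr 1; ext θ
        simp only [eval_monomial, map_mul, map_pow]; ring
      rw [hR]
      rcases n with _ | n
      · rcases m with _ | m <;> simp
      rcases m with _ | m
      · simp
      have hL : ∀ p : ℝ × ℝ, (radialWeight p.1 : ℂ) *
          ((derivative (monomial (n + 1) a)).eval (polarPoint p) *
          (starRingEnd ℂ) ((derivative (monomial (m + 1) b)).eval (polarPoint p))) =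
          (a * (starRingEnd ℂ) b * (n + 1) * (m + 1)) *
            (((radialWeight p.1 * p.1 ^ (n + m) : ℝ) : ℂ) *
            (circlePoint p.2 ^ n * (starRingEnd ℂ) (circlePoint p.2) ^ m)) := by
        intro p
        simp only [derivative_monomial, eval_monomial, map_mul, map_pow, polarPoint, conj_ofReal,
          Nat.add_sub_cancel, Nat.cast_add, Nat.cast_one, map_add, map_one, Complex.conj_natCast]
        push_cast
        ring
      simp_rw [hL]
      unfold squareMeasure
      rw [integral_const_mul, integral_prod_mul (fun r : ℝ => ((radialWeight r * r ^ (n + m) : ℝ) : ℂ))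
        (fun θ : ℝ => circlePoint θ ^ n * (starRingEnd ℂ) (circlePoint θ) ^ m),
        integral_circlePoint_pow_mul_conj_pow]
      by_cases h : n = m
      · subst h
        have h2 := integral_radialWeight_mul_pow n
        rw [two_mul] at h2
        rw [integral_complex_ofReal, h2]
        have : (n : ℂ) + 1 ≠ 0 := by exact_mod_cast Nat.succ_ne_zero n
        simp
        field_simp
      · simp [h]

/-- Littlewood-Paley inequality for polynomials. -/
theorem integral_norm_sq_derivative_le (u : ℂ[X]) :
    ∫ p, radialWeight p.1 * ‖(derivative u).eval (polarPoint p)‖ ^ 2 ∂squareMeasure ≤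
      ∫ θ, ‖u.eval (circlePoint θ)‖ ^ 2 ∂unitMeasure := by
  have h := integral_derivative_mul_conj_derivative u u
  simp only [Complex.mul_conj, Complex.normSq_eq_norm_sq] at h
  simp only [← Complex.ofReal_mul] at h
  rw [integral_complex_ofReal, integral_complex_ofReal, ← Complex.ofReal_sub, Complex.ofReal_inj] at h
  rw [h]
  linarith [sq_nonneg ‖u.eval 0‖]

/-- The functional `k ↦ ∫ k |G|² dθ + ∫ k |G'|² dλ`, where `λ` is the Littlewood-Paley measure. -/
def carlesonFunctional (G : ℂ[X]) (k : ℂ → ℝ) : ℝ :=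
  ∫ θ, k (circlePoint θ) * ‖G.eval (circlePoint θ)‖ ^ 2 ∂unitMeasure +
    ∫ p, radialWeight p.1 * (k (polarPoint p) * ‖(derivative G).eval (polarPoint p)‖ ^ 2)
      ∂squareMeasure

theorem carlesonFunctional_one_le (G : ℂ[X]) :
    carlesonFunctional G (fun _ => 1) ≤ 2 * ∫ θ, ‖G.eval (circlePoint θ)‖ ^ 2 ∂unitMeasure := by
  have := integral_norm_sq_derivative_le G
  simp only [carlesonFunctional, one_mul]
  linarith

theorem carlesonFunctional_add (G : ℂ[X]) {k₁ k₂ : ℂ → ℝ} (h₁ : Continuous k₁)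
    (h₂ : Continuous k₂) :
    carlesonFunctional G (fun z => k₁ z + k₂ z) =
      carlesonFunctional G k₁ + carlesonFunctional G k₂ := by
  simp only [carlesonFunctional, add_mul, mul_add]
  rw [integral_add, integral_add]
  · ring
  all_goals first
    | exact Continuous.integrable_unitMeasure (by fun_prop)
    | exact Continuous.integrable_squareMeasure (by fun_prop)

theorem carlesonFunctional_const_mul (G : ℂ[X]) (c : ℝ) (k : ℂ → ℝ) :
    carlesonFunctional G (fun z => c * k z) = c * carlesonFunctional G k := by
  simp only [carlesonFunctional, mul_add, ← integral_const_mul]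
  congr 2
  · ext; ring
  · ext; ring

theorem carlesonFunctional_mono (G : ℂ[X]) {k₁ k₂ : ℂ → ℝ} (h₁ : Continuous k₁)
    (h₂ : Continuous k₂) (h : ∀ z, k₁ z ≤ k₂ z) :
    carlesonFunctional G k₁ ≤ carlesonFunctional G k₂ := by
  refine add_le_add (integral_mono (Continuous.integrable_unitMeasure (by fun_prop))
    (Continuous.integrable_unitMeasure (by fun_prop)) fun θ => ?_)
    (integral_mono_ae (Continuous.integrable_squareMeasure (by fun_prop))
    (Continuous.integrable_squareMeasure (by fun_prop)) ?_)
  · exact mul_le_mul_of_nonneg_right (h _) (by positivity)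
  · filter_upwards [ae_squareMeasure_fst_mem] with p hp
    exact mul_le_mul_of_nonneg_left (mul_le_mul_of_nonneg_right (h _) (by positivity))
      (radialWeight_nonneg hp)

theorem carlesonFunctional_congr (G : ℂ[X]) {k₁ k₂ : ℂ → ℝ} (h : ∀ z, ‖z‖ ≤ 1 → k₁ z = k₂ z) :
    carlesonFunctional G k₁ = carlesonFunctional G k₂ := by
  unfold carlesonFunctional
  congr 1
  · congr 1; ext θ; rw [h _ (norm_circlePoint θ).le]
  · refine integral_congr_ae ?_
    filter_upwards [ae_squareMeasure_fst_mem] with p hp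
    rw [h _ (norm_polarPoint_le hp)]

theorem norm_sub_sq_le_two_mul (a b : ℂ) : ‖a - b‖ ^ 2 ≤ 2 * ‖a‖ ^ 2 + 2 * ‖b‖ ^ 2 := by
  have := norm_sub_le a b
  nlinarith [sq_nonneg (‖a‖ - ‖b‖), norm_nonneg (a - b), norm_nonneg a, norm_nonneg b]

theorem integral_norm_sq_derivative_mul_le (f K : ℂ[X]) :
    ∫ p, radialWeight p.1 * ‖(derivative f).eval (polarPoint p) * K.eval (polarPoint p)‖ ^ 2
      ∂squareMeasure ≤ 2 * carlesonFunctional K (fun z => ‖f.eval z‖ ^ 2) := by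
  have h1 := integral_norm_sq_derivative_le (f * K)
  have h2 : ∫ p, radialWeight p.1 *
        ‖(derivative f).eval (polarPoint p) * K.eval (polarPoint p)‖ ^ 2 ∂squareMeasure ≤
      ∫ p, (2 * (radialWeight p.1 * ‖(derivative (f * K)).eval (polarPoint p)‖ ^ 2) +
        2 * (radialWeight p.1 * (‖f.eval (polarPoint p)‖ ^ 2 *
          ‖(derivative K).eval (polarPoint p)‖ ^ 2))) ∂squareMeasure := by
    refine integral_mono_ae (Continuous.integrable_squareMeasure (by fun_prop))
      (Continuous.integrable_squareMeasure (by fun_prop)) ?_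
    filter_upwards [ae_squareMeasure_fst_mem] with p hp
    have e : (derivative f).eval (polarPoint p) * K.eval (polarPoint p) =
        (derivative (f * K)).eval (polarPoint p) -
          f.eval (polarPoint p) * (derivative K).eval (polarPoint p) := by
      simp [derivative_mul]
    have := mul_le_mul_of_nonneg_left (norm_sub_sq_le_two_mul
      ((derivative (f * K)).eval (polarPoint p))
      (f.eval (polarPoint p) * (derivative K).eval (polarPoint p))) (radialWeight_nonneg hp)
    rw [← e, norm_mul (f.eval _), mul_pow (‖f.eval _‖)] at this
    linarith
  rw [integral_add (Continuous.integrable_squareMeasure (by fun_prop))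
    (Continuous.integrable_squareMeasure (by fun_prop)), integral_const_mul,
    integral_const_mul] at h2
  simp only [eval_mul, norm_mul, mul_pow] at h1 h2 ⊢
  unfold carlesonFunctional
  linarith

theorem mul_le_half_mul_sq_add {s : ℝ} (hs : 0 < s) (a b : ℝ) :
    a * b ≤ (s * a ^ 2 + s⁻¹ * b ^ 2) / 2 := by
  have h : 0 ≤ s⁻¹ * (s * a - b) ^ 2 := by positivity
  have : s⁻¹ * (s * a - b) ^ 2 = s * a ^ 2 - 2 * (a * b) + s⁻¹ * b ^ 2 := by field_simp; ring
  linarith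

theorem norm_integral_mul_conj_le {J f g G K : ℂ[X]} (hJ : derivative J = derivative f * g)
    (hJ0 : J.eval 0 = 0) {B : ℝ} (hB : 0 ≤ B) (hg : ∀ z : ℂ, ‖z‖ ≤ 1 → ‖g.eval z‖ ≤ B) {M : ℝ}
    (hG : ∫ θ, ‖G.eval (circlePoint θ)‖ ^ 2 ∂unitMeasure ≤ M)
    (hK : ∫ θ, ‖K.eval (circlePoint θ)‖ ^ 2 ∂unitMeasure ≤ M) {s : ℝ} (hs : 0 < s) :
    ‖∫ θ, J.eval (circlePoint θ) * (starRingEnd ℂ) ((G * K).eval (circlePoint θ)) ∂unitMeasure‖ ≤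
      B * (s * (carlesonFunctional G (fun z => ‖f.eval z‖ ^ 2) +
        carlesonFunctional K (fun z => ‖f.eval z‖ ^ 2)) + s⁻¹ * M) := by
  have h := integral_derivative_mul_conj_derivative J (G * K)
  rw [hJ0, zero_mul, sub_zero] at h
  rw [← h]
  have hGd := (integral_norm_sq_derivative_le G).trans hG
  have hKd := (integral_norm_sq_derivative_le K).trans hK
  have hfG := integral_norm_sq_derivative_mul_le f G
  have hfK := integral_norm_sq_derivative_mul_le f K
  refine (norm_integral_le_integral_norm _).trans ?_
  have h2 : ∫ p, ‖(radialWeight p.1 : ℂ) * ((derivative J).eval (polarPoint p) *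
        (starRingEnd ℂ) ((derivative (G * K)).eval (polarPoint p)))‖ ∂squareMeasure ≤
      ∫ p, ((B * s / 2) * (radialWeight p.1 *
          ‖(derivative f).eval (polarPoint p) * K.eval (polarPoint p)‖ ^ 2) +
        (B * s⁻¹ / 2) * (radialWeight p.1 * ‖(derivative G).eval (polarPoint p)‖ ^ 2)) +
        ((B * s / 2) * (radialWeight p.1 *
          ‖(derivative f).eval (polarPoint p) * G.eval (polarPoint p)‖ ^ 2) +
        (B * s⁻¹ / 2) * (radialWeight p.1 * ‖(derivative K).eval (polarPoint p)‖ ^ 2))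
        ∂squareMeasure := by
    refine integral_mono_ae (Continuous.integrable_squareMeasure (by fun_prop))
      (Continuous.integrable_squareMeasure (by fun_prop)) ?_
    filter_upwards [ae_squareMeasure_fst_mem] with p hp
    have hw := radialWeight_nonneg hp
    have hgp := hg _ (norm_polarPoint_le hp)
    generalize polarPoint p = z at *
    rw [hJ, derivative_mul]
    simp only [eval_mul, eval_add, norm_mul, RCLike.norm_conj, Complex.norm_real, Real.norm_eq_abs,
      abs_of_nonneg hw]
    have h3 := norm_add_le ((derivative G).eval z * K.eval z) (G.eval z * (derivative K).eval z)
    rw [norm_mul, norm_mul] at h3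
    have h4 := mul_le_half_mul_sq_add hs (‖(derivative f).eval z‖ * ‖K.eval z‖)
      ‖(derivative G).eval z‖
    have h5 := mul_le_half_mul_sq_add hs (‖(derivative f).eval z‖ * ‖G.eval z‖)
      ‖(derivative K).eval z‖
    calc radialWeight p.1 * (‖(derivative f).eval z‖ * ‖g.eval z‖ *
          ‖(derivative G).eval z * K.eval z + G.eval z * (derivative K).eval z‖)
        ≤ radialWeight p.1 * (‖(derivative f).eval z‖ * B *
          (‖(derivative G).eval z‖ * ‖K.eval z‖ + ‖G.eval z‖ * ‖(derivative K).eval z‖)) := by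
          gcongr
      _ = radialWeight p.1 * (B * (‖(derivative f).eval z‖ * ‖K.eval z‖ * ‖(derivative G).eval z‖ +
          ‖(derivative f).eval z‖ * ‖G.eval z‖ * ‖(derivative K).eval z‖)) := by ring
      _ ≤ _ := mul_le_mul_of_nonneg_left (mul_le_mul_of_nonneg_left (add_le_add h4 h5) hB) hw
      _ = _ := by ring
  refine h2.trans ?_
  have hc : 0 ≤ B * s / 2 := by positivity
  have hd : 0 ≤ B * s⁻¹ / 2 := by positivity
  rw [integral_add, integral_add, integral_add, integral_const_mul, integral_const_mul,
    integral_const_mul, integral_const_mul]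
  · linarith [mul_le_mul_of_nonneg_left hfK hc, mul_le_mul_of_nonneg_left hfG hc,
      mul_le_mul_of_nonneg_left hGd hd, mul_le_mul_of_nonneg_left hKd hd]
  all_goals exact Continuous.integrable_squareMeasure (by fun_prop)

theorem exists_polynomial_approx_of_differentiableOn {f : ℂ → ℂ} {R : ℝ} (hR : 1 < R)
    (hf : DifferentiableOn ℂ f (Metric.ball 0 R)) {ε : ℝ} (hε : 0 < ε) :
    ∃ p : ℂ[X], ∀ z : ℂ, ‖z‖ ≤ 1 → ‖f z - p.eval z‖ ≤ ε := by
  obtain ⟨r, hr1, hrR⟩ := exists_between hR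
  lift r to NNReal using by linarith
  obtain ⟨r', hr1', hrr'⟩ := exists_between hr1
  lift r' to NNReal using by linarith
  have hd : DifferentiableOn ℂ f (Metric.closedBall 0 r) :=
    hf.mono (Metric.closedBall_subset_ball hrR)
  have hs := hd.hasFPowerSeriesOnBall (by exact_mod_cast (by linarith : (0 : ℝ) < r))
  have hu := hs.tendstoUniformlyOn' (r' := r') (by exact_mod_cast hrr')
  rw [Metric.tendstoUniformlyOn_iff] at hu
  obtain ⟨n, hn⟩ := (hu ε hε).exists
  refine ⟨∑ k ∈ Finset.range n, Polynomial.C ((cauchyPowerSeries f 0 r).coeff k) * X ^ k,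
    fun z hz => ?_⟩
  have := (hn z (by simpa using lt_of_le_of_lt hz hr1')).le
  rw [dist_eq_norm] at this
  have e : (cauchyPowerSeries f 0 r).partialSum n (z - 0) =
      (∑ k ∈ Finset.range n, Polynomial.C ((cauchyPowerSeries f 0 r).coeff k) * X ^ k).eval z := by
    simp only [FormalMultilinearSeries.partialSum, eval_finsetSum, sub_zero, eval_mul, eval_C,
      eval_pow, eval_X, FormalMultilinearSeries.apply_eq_pow_smul_coeff, smul_eq_mul]
    exact Finset.sum_congr rfl fun _ _ => mul_comm _ _
  rwa [← e]

/-- Real parts of analytic polynomials are dense in the real continuous functions on the circle. -/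
theorem exists_polynomial_re_approx {v : ℂ → ℝ} (hv : Continuous v) {ε : ℝ} (hε : 0 < ε) :
    ∃ P : ℂ[X], ∀ θ, |(P.eval (circlePoint θ)).re - v (circlePoint θ)| ≤ ε := by
  let V : C(AddCircle (1 : ℝ), ℂ) := ⟨fun x => (v (AddCircle.toCircle x) : ℂ), by
    have := AddCircle.continuous_toCircle (T := (1 : ℝ))
    fun_prop⟩
  have hV : V ∈ (Submodule.span ℂ (Set.range <| @fourier 1)).topologicalClosure := by
    rw [span_fourier_closure_eq_top]; trivial
  obtain ⟨p, hp, hpV⟩ := Metric.mem_closure_iff.mp hV ε hε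
  have key : ∃ P Q : ℂ[X], ∀ x : AddCircle (1 : ℝ), p x =
      P.eval (AddCircle.toCircle x : ℂ) +
        (starRingEnd ℂ) (Q.eval (AddCircle.toCircle x : ℂ)) := by
    clear hpV
    induction hp using Submodule.span_induction with
    | mem f hf =>
      obtain ⟨n, rfl⟩ := hf
      rcases Int.eq_nat_or_neg n with ⟨k, rfl | rfl⟩
      · refine ⟨X ^ k, 0, fun x => ?_⟩
        simp [fourier_apply, AddCircle.toCircle_nsmul]
      · refine ⟨0, X ^ k, fun x => ?_⟩
        rw [fourier_neg]
        simp [fourier_apply, AddCircle.toCircle_nsmul]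
    | zero => exact ⟨0, 0, by simp⟩
    | add f g _ _ hf hg =>
      obtain ⟨P, Q, h⟩ := hf
      obtain ⟨P', Q', h'⟩ := hg
      refine ⟨P + P', Q + Q', fun x => ?_⟩
      simp [h, h']; ring
    | smul a f _ hf =>
      obtain ⟨P, Q, h⟩ := hf
      refine ⟨Polynomial.C a * P, Polynomial.C ((starRingEnd ℂ) a) * Q, fun x => ?_⟩
      simp [h]; ring
  obtain ⟨P, Q, h⟩ := key
  refine ⟨P + Q, fun θ => ?_⟩
  have e : (AddCircle.toCircle (θ : AddCircle (1 : ℝ)) : ℂ) = circlePoint θ := by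
    rw [AddCircle.toCircle_apply_mk, Circle.coe_exp, circlePoint]
    congr 1; push_cast; ring
  have h1 : ‖(V - p) (θ : AddCircle (1 : ℝ))‖ ≤ ε :=
    ((V - p).norm_coe_le_norm _).trans (by rw [← dist_eq_norm]; exact hpV.le)
  have h2 := (Complex.abs_re_le_norm _).trans h1
  rw [ContinuousMap.sub_apply, h, e] at h2
  simp only [V, ContinuousMap.coe_mk, e, Complex.sub_re, Complex.ofReal_re, Complex.add_re,
    Complex.conj_re] at h2
  rw [eval_add, Complex.add_re, abs_sub_comm]
  exact h2

/-- An approximate factorisation `h ≈ G K` of a polynomial, with `‖G‖₂²` and `‖K‖₂²` controlled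
by `‖h‖₁`. -/
theorem exists_approx_factorization (h : ℂ[X]) {δ : ℝ} (hδ : 0 < δ) :
    ∃ G K : ℂ[X],
      ∫ θ, ‖G.eval (circlePoint θ)‖ ^ 2 ∂unitMeasure ≤
        (2 * Real.exp 1 + 2) * (∫ θ, ‖h.eval (circlePoint θ)‖ ∂unitMeasure + 1) ∧
      ∫ θ, ‖K.eval (circlePoint θ)‖ ^ 2 ∂unitMeasure ≤
        (2 * Real.exp 1 + 2) * (∫ θ, ‖h.eval (circlePoint θ)‖ ∂unitMeasure + 1) ∧
      ∀ θ, ‖(G * K).eval (circlePoint θ) - h.eval (circlePoint θ)‖ ≤ δ := by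
  have hlog : Continuous fun z => Real.log (‖h.eval z‖ + 1) :=
    Continuous.log (by fun_prop) fun z => by positivity
  obtain ⟨P, hP⟩ := exists_polynomial_re_approx hlog one_pos
  obtain ⟨H, hH⟩ := (isCompact_closedBall (0 : ℂ) 1).exists_bound_of_continuousOn
    (f := fun z => h.eval z) (by fun_prop)
  have hH' : ∀ θ, ‖h.eval (circlePoint θ)‖ ≤ H := fun θ => hH _ (by simp)
  have hH0 : 0 ≤ H := (norm_nonneg _).trans (hH' 0)
  have he1 : 1 ≤ Real.exp 1 := Real.one_le_exp zero_le_one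
  set S := Real.exp 1 * (H + 1) with hS
  have hS1 : 1 ≤ S := by nlinarith
  set η := min (1 / (H + 1)) (δ / ((H + 1) * (2 * S + 1))) with hη
  have hη0 : 0 < η := by positivity
  have hη1 : η * (H + 1) ≤ 1 := by
    rw [← le_div_iff₀ (by positivity)]; exact min_le_left _ _
  have hη2 : η * ((H + 1) * (2 * S + 1)) ≤ δ := by
    rw [← le_div_iff₀ (by positivity)]; exact min_le_right _ _
  obtain ⟨p, hp⟩ := exists_polynomial_approx_of_differentiableOn (R := 2) one_lt_two
    (f := fun z => Complex.exp (P.eval z / 2)) (by fun_prop) hη0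
  obtain ⟨q, hq⟩ := exists_polynomial_approx_of_differentiableOn (R := 2) one_lt_two
    (f := fun z => Complex.exp (-(P.eval z / 2))) (by fun_prop) hη0
  have hE : ∀ θ, ‖Complex.exp (P.eval (circlePoint θ) / 2)‖ ^ 2 ≤
      Real.exp 1 * (‖h.eval (circlePoint θ)‖ + 1) := by
    intro θ
    rw [Complex.norm_exp, ← Real.exp_nat_mul,
      ← Real.exp_log (by positivity : 0 < ‖h.eval (circlePoint θ)‖ + 1), ← Real.exp_add]
    refine Real.exp_le_exp.mpr ?_
    have := (abs_le.mp (hP θ)).2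
    simp only [Complex.div_ofNat_re]
    push_cast
    linarith
  have hE' : ∀ θ, ‖Complex.exp (-(P.eval (circlePoint θ) / 2))‖ ^ 2 *
      (‖h.eval (circlePoint θ)‖ + 1) ≤ Real.exp 1 := by
    intro θ
    rw [Complex.norm_exp, ← Real.exp_nat_mul,
      ← Real.exp_log (by positivity : 0 < ‖h.eval (circlePoint θ)‖ + 1), ← Real.exp_add]
    refine Real.exp_le_exp.mpr ?_
    have := (abs_le.mp (hP θ)).1
    simp only [Complex.div_ofNat_re, Complex.neg_re]
    push_cast
    linarith
  have hint : ∀ F : ℝ → ℝ, Continuous F →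
      (∀ θ, F θ ≤ (2 * Real.exp 1 + 2) * (‖h.eval (circlePoint θ)‖ + 1)) →
      ∫ θ, F θ ∂unitMeasure ≤
        (2 * Real.exp 1 + 2) * (∫ θ, ‖h.eval (circlePoint θ)‖ ∂unitMeasure + 1) := by
    intro F hF hle
    refine (integral_mono hF.integrable_unitMeasure
      (Continuous.integrable_unitMeasure (by fun_prop)) hle).trans_eq ?_
    rw [integral_const_mul, integral_add (Continuous.integrable_unitMeasure (by fun_prop))
      (integrable_const _)]
    simp
  refine ⟨p, h * q, hint _ (by fun_prop) fun θ => ?_, hint _ (by fun_prop) fun θ => ?_,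
    fun θ => ?_⟩
  · have h1 := hp _ (norm_circlePoint θ).le
    have h2 := hE θ
    have h3 := norm_nonneg (h.eval (circlePoint θ))
    have h4 := norm_sub_sq_le_two_mul (Complex.exp (P.eval (circlePoint θ) / 2))
      (Complex.exp (P.eval (circlePoint θ) / 2) - p.eval (circlePoint θ))
    rw [sub_sub_cancel] at h4
    have h5 : η ≤ 1 := by nlinarith
    have h6 := pow_le_one₀ (n := 2) (norm_nonneg _) (h1.trans h5)
    nlinarith
  · have h1 := hq _ (norm_circlePoint θ).le
    have h2 := hE' θ
    have h3 := norm_nonneg (h.eval (circlePoint θ))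
    have h4 := norm_sub_sq_le_two_mul
      (h.eval (circlePoint θ) * Complex.exp (-(P.eval (circlePoint θ) / 2)))
      (h.eval (circlePoint θ) *
        (Complex.exp (-(P.eval (circlePoint θ) / 2)) - q.eval (circlePoint θ)))
    rw [← mul_sub, sub_sub_cancel] at h4
    have h6 : ‖h.eval (circlePoint θ) *
        (Complex.exp (-(P.eval (circlePoint θ) / 2)) - q.eval (circlePoint θ))‖ ≤ 1 := by
      rw [norm_mul]
      have := mul_le_mul (hH' θ) h1 (norm_nonneg _) hH0
      nlinarith
    have h7 := pow_le_one₀ (n := 2) (norm_nonneg _) h6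
    have h8 : ‖h.eval (circlePoint θ) * Complex.exp (-(P.eval (circlePoint θ) / 2))‖ ^ 2 ≤
        Real.exp 1 * (‖h.eval (circlePoint θ)‖ + 1) := by
      rw [norm_mul, mul_pow]
      have := mul_le_mul_of_nonneg_left h2 h3
      nlinarith [sq_nonneg ‖Complex.exp (-(P.eval (circlePoint θ) / 2))‖]
    rw [eval_mul]
    nlinarith
  · have h1 := hp _ (norm_circlePoint θ).le
    have h1' := hq _ (norm_circlePoint θ).le
    have h2 := hE θ
    have h2' := hE' θ
    have h3 := norm_nonneg (h.eval (circlePoint θ))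
    have h4 := hH' θ
    have hEE : Complex.exp (P.eval (circlePoint θ) / 2) *
        Complex.exp (-(P.eval (circlePoint θ) / 2)) = 1 := by
      rw [← Complex.exp_add]; simp
    have hn : ∀ x : ℝ, 0 ≤ x → x ^ 2 ≤ S → x ≤ S := fun x hx hxS => by nlinarith
    simp only [eval_mul]
    generalize Complex.exp (P.eval (circlePoint θ) / 2) = E at *
    generalize Complex.exp (-(P.eval (circlePoint θ) / 2)) = E' at *
    generalize p.eval (circlePoint θ) = p at *
    generalize q.eval (circlePoint θ) = q at *
    generalize h.eval (circlePoint θ) = a at *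
    have hES : ‖E‖ ≤ S := hn _ (norm_nonneg _) (by nlinarith)
    have hES' : ‖E'‖ ≤ S := hn _ (norm_nonneg _) (by nlinarith [sq_nonneg ‖E'‖])
    have hqS : ‖q‖ ≤ S + 1 := by
      have := norm_sub_le E' (E' - q)
      rw [sub_sub_cancel] at this
      nlinarith
    have e : p * (a * q) - a = -(a * ((E - p) * q + E * (E' - q))) := by
      linear_combination a * hEE
    rw [e, norm_neg, norm_mul]
    have h5 : ‖(E - p) * q + E * (E' - q)‖ ≤ η * (S + 1) + S * η := by
      refine (norm_add_le _ _).trans (add_le_add ?_ ?_) <;> rw [norm_mul]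
      · exact mul_le_mul h1 hqS (norm_nonneg _) hη0.le
      · exact mul_le_mul hES h1' (norm_nonneg _) (by linarith)
    refine le_trans ?_ hη2
    have h6 := mul_le_mul h4 h5 (norm_nonneg _) hH0
    have : 0 ≤ η * (2 * S + 1) := by positivity
    nlinarith

/-- The coordinate function of the disc algebra. -/
def discCoordinate : ↥discAlgebra :=
  ⟨⟨fun z => z, continuous_subtype_val⟩, ⟨fun z => z, differentiableOn_id, fun _ => rfl⟩⟩

/-- Polynomials as elements of the disc algebra. -/
def polyToDisc : ℂ[X] →ₐ[ℂ] ↥discAlgebra := aeval discCoordinate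

theorem polyToDisc_apply (p : ℂ[X]) (z : closedDisc) :
    (polyToDisc p : C(closedDisc, ℂ)) z = p.eval (z : ℂ) := by
  unfold polyToDisc
  induction p using Polynomial.induction_on' with
  | add p q hp hq => simpa using congrArg₂ (· + ·) hp hq
  | monomial n a =>
    rw [aeval_monomial]
    simp [discCoordinate, Algebra.algebraMap_eq_smul_one]

theorem discAlgebra_norm_le {f : ↥discAlgebra} {C : ℝ} (hC : 0 ≤ C)
    (h : ∀ z : closedDisc, ‖(f : C(closedDisc, ℂ)) z‖ ≤ C) : ‖f‖ ≤ C :=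
  (ContinuousMap.norm_le _ hC).mpr h

theorem discAlgebra_norm_apply_le (f : ↥discAlgebra) (z : closedDisc) :
    ‖(f : C(closedDisc, ℂ)) z‖ ≤ ‖f‖ :=
  ContinuousMap.norm_coe_le_norm (f : C(closedDisc, ℂ)) z

theorem IsDerivation.apply_one {D : ↥discAlgebra →L[ℂ] DADual} (hD : IsDerivation D)
    (u : ↥discAlgebra) : D 1 u = 0 := by
  have := hD 1 1 u
  simpa using this

theorem IsDerivation.apply_pow {D : ↥discAlgebra →L[ℂ] DADual} (hD : IsDerivation D)
    (f : ↥discAlgebra) (n : ℕ) (u : ↥discAlgebra) :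
    D (f ^ (n + 1)) u = (n + 1) * D f (f ^ n * u) := by
  induction n generalizing u with
  | zero => simp
  | succ n ih =>
    rw [pow_succ, hD, ih, show f ^ n * (f * u) = f ^ (n + 1) * u by ring]
    push_cast; ring

theorem IsDerivation.apply_polyToDisc {D : ↥discAlgebra →L[ℂ] DADual} (hD : IsDerivation D)
    (p : ℂ[X]) (u : ↥discAlgebra) :
    D (polyToDisc p) u = D discCoordinate (polyToDisc (derivative p) * u) := by
  induction p using Polynomial.induction_on' with
  | add p q hp hq =>
    simp only [map_add, _root_.add_apply, add_mul, hp, hq]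
  | monomial n a =>
    have e : ∀ (m : ℕ) (c : ℂ), polyToDisc (monomial m c) = c • discCoordinate ^ m := by
      intro m c
      rw [polyToDisc, aeval_monomial, Algebra.smul_def]
    rw [derivative_monomial, e, e]
    rcases n with _ | n
    · simp [hD.apply_one]
    · simp only [map_smul, _root_.smul_apply, hD.apply_pow, Nat.add_sub_cancel,
        smul_mul_assoc, smul_eq_mul]
      push_cast; ring

theorem exists_derivative_eq (p : ℂ[X]) : ∃ J : ℂ[X], derivative J = p ∧ J.eval 0 = 0 := by
  induction p using Polynomial.induction_on' with
  | add p q hp hq =>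
    obtain ⟨P, hP, hP0⟩ := hp
    obtain ⟨Q, hQ, hQ0⟩ := hq
    exact ⟨P + Q, by simp [hP, hQ], by simp [hP0, hQ0]⟩
  | monomial n a =>
    refine ⟨monomial (n + 1) (a / (n + 1)), ?_, by simp⟩
    rw [derivative_monomial]
    have : (n : ℂ) + 1 ≠ 0 := by exact_mod_cast Nat.succ_ne_zero n
    simp [this]

/-- The exponential of an element of the disc algebra. -/
def discExp (F : ↥discAlgebra) : ↥discAlgebra :=
  ⟨NormedSpace.exp (F : C(closedDisc, ℂ)), by
    obtain ⟨G, hG, h⟩ := F.2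
    refine ⟨fun z => Complex.exp (G z), hG.cexp, fun z => ?_⟩
    have := NormedSpace.map_exp (ContinuousMap.evalAlgHom ℂ ℂ z) (continuous_eval_const z)
      (F : C(closedDisc, ℂ))
    show _ = Complex.exp (G z)
    rw [← h z, Complex.exp_eq_exp_ℂ]
    exact this⟩

theorem discExp_apply (F : ↥discAlgebra) (z : closedDisc) :
    (discExp F : C(closedDisc, ℂ)) z = Complex.exp ((F : C(closedDisc, ℂ)) z) := by
  have := NormedSpace.map_exp (ContinuousMap.evalAlgHom ℂ ℂ z) (continuous_eval_const z)
      (F : C(closedDisc, ℂ))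
  rw [Complex.exp_eq_exp_ℂ]
  exact this

theorem hasSum_discExp (F : ↥discAlgebra) :
    HasSum (fun n : ℕ => ((n.factorial : ℂ)⁻¹) • F ^ n) (discExp F) := by
  have h := NormedSpace.exp_series_hasSum_exp' (𝕂 := ℂ) (F : C(closedDisc, ℂ))
  have hi : IsInducing (discAlgebra.val : ↥discAlgebra →ₐ[ℂ] C(closedDisc, ℂ)) :=
    IsInducing.subtypeVal
  rw [← hi.hasSum_iff]
  exact h

theorem IsDerivation.apply_discExp {D : ↥discAlgebra →L[ℂ] DADual} (hD : IsDerivation D)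
    (F u : ↥discAlgebra) : D (discExp F) u = D F (discExp F * u) := by
  have h1 : HasSum (fun n : ℕ => D (((n.factorial : ℂ)⁻¹) • F ^ n) u) (D (discExp F) u) :=
    ((hasSum_discExp F).mapL D).mapL (ContinuousLinearMap.apply ℂ ℂ u)
  have h2 : HasSum (fun n : ℕ => D F (((n.factorial : ℂ)⁻¹) • F ^ n * u))
      (D F (discExp F * u)) :=
    ((hasSum_discExp F).mul_right u).mapL (D F)
  rw [← hasSum_nat_add_iff' 1] at h1
  simp only [Finset.sum_range_one, pow_zero, map_smul, _root_.smul_apply,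
    hD.apply_one, smul_zero, sub_zero, hD.apply_pow] at h1
  refine h1.unique ?_
  have he : (fun n : ℕ => (((n + 1).factorial : ℂ)⁻¹) • (((n : ℂ) + 1) * D F (F ^ n * u))) =
      fun n : ℕ => D F (((n.factorial : ℂ)⁻¹) • F ^ n * u) := ?_
  · rw [he]; exact h2
  funext n
  rw [smul_mul_assoc, map_smul, Nat.factorial_succ, smul_eq_mul, smul_eq_mul]
  have : (n : ℂ) + 1 ≠ 0 := by exact_mod_cast Nat.succ_ne_zero n
  have : (n.factorial : ℂ) ≠ 0 := by exact_mod_cast n.factorial_ne_zero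
  push_cast
  field_simp

theorem norm_le_of_norm_circle_le {f : ℂ → ℂ} (hf : Differentiable ℂ f) {C : ℝ}
    (h : ∀ θ, ‖f (circlePoint θ)‖ ≤ C) {z : ℂ} (hz : ‖z‖ ≤ 1) : ‖f z‖ ≤ C := by
  refine Complex.norm_le_of_forall_mem_frontier_norm_le (U := Metric.ball 0 1)
    Metric.isBounded_ball hf.diffContOnCl (fun w hw => ?_) ?_
  · rw [frontier_ball _ one_ne_zero, mem_sphere_zero_iff_norm] at hw
    obtain ⟨θ, rfl⟩ := exists_circlePoint_eq hw
    exact h θ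
  · rw [closure_ball _ one_ne_zero]; simpa using hz

theorem IsDerivation.norm_apply_one_le {D : ↥discAlgebra →L[ℂ] DADual} (hD : IsDerivation D)
    {F : ℂ[X]} (hF : ∀ θ, |(F.eval (circlePoint θ)).re| ≤ 1) :
    ‖D (polyToDisc F) 1‖ ≤ ‖D‖ * Real.exp 1 ^ 2 := by
  have hexp : ∀ P : ℂ[X], (∀ θ, |(P.eval (circlePoint θ)).re| ≤ 1) →
      ‖discExp (polyToDisc P)‖ ≤ Real.exp 1 := by
    intro P hP
    refine discAlgebra_norm_le (Real.exp_pos 1).le fun z => ?_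
    rw [discExp_apply, polyToDisc_apply]
    refine norm_le_of_norm_circle_le (f := fun z => Complex.exp (P.eval z)) (by fun_prop)
      (fun θ => ?_) (mem_closedBall_zero_iff.mp z.2)
    rw [Complex.norm_exp]
    exact Real.exp_le_exp.mpr (abs_le.mp (hP θ)).2
  have h1 := hD.apply_discExp (polyToDisc F) (discExp (polyToDisc (-F)))
  have h2 : discExp (polyToDisc F) * discExp (polyToDisc (-F)) = 1 := by
    ext z
    have : Complex.exp (F.eval (z : ℂ)) * Complex.exp (-F.eval (z : ℂ)) = 1 := by
      rw [← Complex.exp_add]; simp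
    simpa [discExp_apply, polyToDisc_apply] using this
  rw [h2] at h1
  rw [← h1]
  refine (ContinuousLinearMap.le_opNorm _ _).trans ?_
  have h3 := hexp F hF
  have h4 := hexp (-F) (by simpa using hF)
  calc ‖D (discExp (polyToDisc F))‖ * ‖discExp (polyToDisc (-F))‖
      ≤ (‖D‖ * Real.exp 1) * Real.exp 1 := by
        refine mul_le_mul ((D.le_opNorm _).trans ?_) h4 (norm_nonneg _) (by positivity)
        gcongr
    _ = _ := by ring

/-- The `n`-th Cesàro mean of the formal power series `∑ a (m + 1) X ^ (m + 1)`. -/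
def cesaroPoly (n : ℕ) (a : ℕ → ℂ) : ℂ[X] :=
  ∑ j ∈ Finset.range n, ∑ m ∈ Finset.range j, Polynomial.C ((n : ℂ)⁻¹ * a (m + 1)) * X ^ (m + 1)

theorem eval_cesaroPoly (n : ℕ) (a : ℕ → ℂ) (z : ℂ) :
    (cesaroPoly n a).eval z = ∑ j ∈ Finset.range n, ∑ m ∈ Finset.range j,
      (n : ℂ)⁻¹ * a (m + 1) * z ^ (m + 1) := by
  simp [cesaroPoly, eval_finsetSum]

theorem sum_one_add_two_mul_re_eq_norm_sq {ζ : ℂ} (hζ : ‖ζ‖ = 1) (n : ℕ) :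
    ∑ j ∈ Finset.range n, (1 + 2 * (∑ m ∈ Finset.range j, ζ ^ (m + 1)).re) =
      ‖∑ j ∈ Finset.range n, ζ ^ j‖ ^ 2 := by
  have hc : ζ * (starRingEnd ℂ) ζ = 1 := by
    rw [Complex.mul_conj, Complex.normSq_eq_norm_sq]; simp [hζ]
  have hs : ∀ n : ℕ, ζ ^ n * (starRingEnd ℂ) (∑ j ∈ Finset.range n, ζ ^ j) =
      ∑ m ∈ Finset.range n, ζ ^ (m + 1) := by
    intro n
    induction n with
    | zero => simp
    | succ n ih =>
      have h1 : ζ ^ (n + 1) * (starRingEnd ℂ) ζ ^ n = ζ := by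
        rw [pow_succ', mul_assoc, ← mul_pow, hc, one_pow, mul_one]
      rw [Finset.sum_range_succ, map_add, mul_add, map_pow, h1, pow_succ', mul_assoc, ih,
        Finset.sum_range_succ', Finset.mul_sum]
      simp [pow_succ']
  induction n with
  | zero => simp
  | succ n ih =>
    rw [Finset.sum_range_succ, ih, Finset.sum_range_succ, ← hs n, ← Complex.normSq_eq_norm_sq,
      ← Complex.normSq_eq_norm_sq, Complex.normSq_add, map_pow]
    have h1 : Complex.normSq ζ = 1 := by rw [Complex.normSq_eq_norm_sq, hζ]; simp
    have h2 : ((∑ j ∈ Finset.range n, ζ ^ j) * (starRingEnd ℂ) (ζ ^ n)).re =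
        (ζ ^ n * (starRingEnd ℂ) (∑ j ∈ Finset.range n, ζ ^ j)).re := by
      rw [← Complex.conj_re, map_mul, Complex.conj_conj, mul_comm]
    rw [h1, h2]
    simp; ring

/-- Positivity of the Fejér kernel. -/
theorem neg_one_le_two_mul_re_cesaroPoly {ζ : ℂ} (hζ : ‖ζ‖ = 1) {n : ℕ} (hn : 0 < n) :
    0 ≤ 1 + 2 * ((cesaroPoly n fun _ => 1).eval ζ).re := by
  have h := sum_one_add_two_mul_re_eq_norm_sq hζ n
  rw [Finset.sum_add_distrib, ← Finset.mul_sum, ← Complex.re_sum] at h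
  have e : (cesaroPoly n fun _ => 1).eval ζ =
      ((n : ℝ)⁻¹ : ℝ) * ∑ j ∈ Finset.range n, ∑ m ∈ Finset.range j, ζ ^ (m + 1) := by
    rw [eval_cesaroPoly]
    simp [Finset.mul_sum]
  have hn' : (0 : ℝ) < n := by exact_mod_cast hn
  rw [e, Complex.re_ofReal_mul]
  simp only [Finset.sum_const, Finset.card_range, nsmul_eq_mul, mul_one] at h
  have : 1 + 2 * ((n : ℝ)⁻¹ *
      (∑ j ∈ Finset.range n, ∑ m ∈ Finset.range j, ζ ^ (m + 1)).re) =
      (n : ℝ)⁻¹ * ‖∑ j ∈ Finset.range n, ζ ^ j‖ ^ 2 := by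
    rw [← h]; field_simp
  rw [this]; positivity

theorem integral_cesaroPoly_mul_conj (n : ℕ) (z : ℂ) :
    ∫ θ, (cesaroPoly n fun _ => 1).eval (z * (starRingEnd ℂ) (circlePoint θ)) ∂unitMeasure = 0 := by
  simp only [eval_cesaroPoly]
  rw [integral_finsetSum _ fun i _ => Continuous.integrable_unitMeasure (by fun_prop)]
  refine Finset.sum_eq_zero fun j _ => ?_
  rw [integral_finsetSum _ fun i _ => Continuous.integrable_unitMeasure (by fun_prop)]
  refine Finset.sum_eq_zero fun m _ => ?_
  rw [integral_const_mul]
  simp only [mul_pow]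
  rw [integral_const_mul]
  have := integral_circlePoint_pow_mul_conj_pow 0 (m + 1)
  simp only [pow_zero, one_mul] at this
  rw [this]; simp

/-- Fourier coefficients of a real function `p` on the circle, parametrised by `[0, 1]`. -/
def unitFourierCoeff (p : ℝ → ℝ) (m : ℕ) : ℂ :=
  ∫ θ, (p θ : ℂ) * (starRingEnd ℂ) (circlePoint θ) ^ m ∂unitMeasure

theorem abs_re_cesaroPoly_unitFourierCoeff_le {p : ℝ → ℝ} (hp : Continuous p)
    (hp1 : ∀ θ, |p θ| ≤ 1) {n : ℕ} (hn : 0 < n) {z : ℂ} (hz : ‖z‖ = 1) :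
    |((cesaroPoly n (unitFourierCoeff p)).eval z).re| ≤ 1 := by
  have e : (cesaroPoly n (unitFourierCoeff p)).eval z =
      ∫ θ, (p θ : ℂ) * (cesaroPoly n fun _ => 1).eval (z * (starRingEnd ℂ) (circlePoint θ))
        ∂unitMeasure := by
    simp only [eval_cesaroPoly, Finset.mul_sum]
    rw [integral_finsetSum _ fun i _ => Continuous.integrable_unitMeasure (by fun_prop)]
    refine Finset.sum_congr rfl fun j _ => ?_
    rw [integral_finsetSum _ fun i _ => Continuous.integrable_unitMeasure (by fun_prop)]
    refine Finset.sum_congr rfl fun m _ => ?_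
    rw [unitFourierCoeff, mul_assoc, mul_comm _ (z ^ (m + 1)), ← mul_assoc, ← integral_const_mul]
    congr 1; ext θ; ring
  have hre : ∀ F : ℝ → ℂ, Continuous F → (∫ θ, F θ ∂unitMeasure).re =
      ∫ θ, (F θ).re ∂unitMeasure := fun F hF =>
    (integral_re hF.integrable_unitMeasure).symm
  have h0 := congrArg Complex.re (integral_cesaroPoly_mul_conj n z)
  rw [hre _ (by fun_prop)] at h0
  rw [e, hre _ (by fun_prop)]
  refine (abs_integral_le_integral_abs).trans ?_
  calc ∫ θ, |((p θ : ℂ) *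
        (cesaroPoly n fun _ => 1).eval (z * (starRingEnd ℂ) (circlePoint θ))).re| ∂unitMeasure
      ≤ ∫ θ, (1 + ((cesaroPoly n fun _ => 1).eval
          (z * (starRingEnd ℂ) (circlePoint θ))).re) ∂unitMeasure := by
        refine integral_mono (Continuous.integrable_unitMeasure (by fun_prop))
          (Continuous.integrable_unitMeasure (by fun_prop)) fun θ => ?_
        have h1 := neg_one_le_two_mul_re_cesaroPoly
          (ζ := z * (starRingEnd ℂ) (circlePoint θ)) (by simp [hz]) hn
        simp only [Complex.re_ofReal_mul, abs_mul]
        refine (mul_le_of_le_one_left (abs_nonneg _) (hp1 θ)).trans ?_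
        rw [abs_le]; constructor <;> linarith
    _ = 1 := by
        rw [integral_add (integrable_const _) (Continuous.integrable_unitMeasure (by fun_prop)),
          h0]
        simp

/-- The Cesàro means of the symbol of the functional `f ↦ D f 1`. -/
def symbolPoly (D : ↥discAlgebra →L[ℂ] DADual) (n : ℕ) : ℂ[X] :=
  cesaroPoly n fun m => (starRingEnd ℂ) (D (polyToDisc (X ^ m)) 1)

theorem integral_mul_conj_symbolPoly (D : ↥discAlgebra →L[ℂ] DADual) (n : ℕ) {p : ℝ → ℝ}
    (hp : Continuous p) :
    ∫ θ, (p θ : ℂ) * (starRingEnd ℂ) ((symbolPoly D n).eval (circlePoint θ)) ∂unitMeasure =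
      D (polyToDisc (cesaroPoly n (unitFourierCoeff p))) 1 := by
  simp only [symbolPoly, eval_cesaroPoly, map_sum, Finset.mul_sum]
  rw [integral_finsetSum _ fun i _ => Continuous.integrable_unitMeasure (by fun_prop), cesaroPoly]
  simp only [map_sum, _root_.sum_apply]
  refine Finset.sum_congr rfl fun j _ => ?_
  rw [integral_finsetSum _ fun i _ => Continuous.integrable_unitMeasure (by fun_prop)]
  refine Finset.sum_congr rfl fun m _ => ?_
  rw [← Polynomial.smul_eq_C_mul, map_smul, map_smul, _root_.smul_apply, smul_eq_mul,
    unitFourierCoeff, mul_assoc, mul_comm (integral _ _), ← mul_assoc, ← integral_const_mul]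
  congr 1; ext θ
  simp only [map_mul, map_pow, Complex.conj_conj, map_inv₀, Complex.conj_natCast]
  ring

theorem IsDerivation.integral_norm_symbolPoly_le {D : ↥discAlgebra →L[ℂ] DADual}
    (hD : IsDerivation D) {n : ℕ} (hn : 0 < n) :
    ∫ θ, ‖(symbolPoly D n).eval (circlePoint θ)‖ ∂unitMeasure ≤
      2 * (‖D‖ * Real.exp 1 ^ 2) + 1 := by
  have key : ∀ p : ℝ → ℝ, Continuous p → (∀ θ, |p θ| ≤ 1) →
      ‖∫ θ, (p θ : ℂ) * (starRingEnd ℂ) ((symbolPoly D n).eval (circlePoint θ)) ∂unitMeasure‖ ≤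
        ‖D‖ * Real.exp 1 ^ 2 := by
    intro p hp hp1
    rw [integral_mul_conj_symbolPoly D n hp]
    exact hD.norm_apply_one_le fun θ =>
      abs_re_cesaroPoly_unitFourierCoeff_le hp hp1 hn (norm_circlePoint θ)
  set h : ℝ → ℂ := fun θ => (symbolPoly D n).eval (circlePoint θ) with hh
  have hc : Continuous h := by fun_prop
  have hpos : ∀ θ, ‖h θ‖ + 1 ≠ 0 := fun θ => by positivity
  have hbd : ∀ θ (x : ℝ), |x| ≤ ‖h θ‖ → |x / (‖h θ‖ + 1)| ≤ 1 := by
    intro θ x hx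
    rw [abs_div, abs_of_pos (by positivity : 0 < ‖h θ‖ + 1), div_le_one (by positivity)]
    linarith
  have hc1 : Continuous fun θ => (h θ).re / (‖h θ‖ + 1) := by
    exact (Complex.continuous_re.comp hc).div (by fun_prop) hpos
  have hc2 : Continuous fun θ => (h θ).im / (‖h θ‖ + 1) := by
    exact (Complex.continuous_im.comp hc).div (by fun_prop) hpos
  have hc3 : Continuous fun θ => ‖h θ‖ ^ 2 / (‖h θ‖ + 1) := by
    exact Continuous.div (by fun_prop) (by fun_prop) hpos
  have k1 := key _ hc1 fun θ => hbd θ _ (Complex.abs_re_le_norm _)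
  have k2 := key _ hc2 fun θ => hbd θ _ (Complex.abs_im_le_norm _)
  have hsum : ((∫ θ, ‖h θ‖ ^ 2 / (‖h θ‖ + 1) ∂unitMeasure : ℝ) : ℂ) =
      ∫ θ, (((h θ).re / (‖h θ‖ + 1) : ℝ) : ℂ) * (starRingEnd ℂ) (h θ) ∂unitMeasure +
      I * ∫ θ, (((h θ).im / (‖h θ‖ + 1) : ℝ) : ℂ) * (starRingEnd ℂ) (h θ) ∂unitMeasure := by
    rw [← integral_const_mul, ← integral_add (Continuous.integrable_unitMeasure (by fun_prop))
      (Continuous.integrable_unitMeasure (by fun_prop)), ← integral_complex_ofReal]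
    congr 1; ext θ
    have h1 : (((h θ).re : ℂ) + I * (h θ).im) * (starRingEnd ℂ) (h θ) = (‖h θ‖ : ℂ) ^ 2 := by
      rw [mul_comm I, Complex.re_add_im, Complex.mul_conj, Complex.normSq_eq_norm_sq]
      push_cast; rfl
    push_cast
    rw [← h1]
    ring
  have h4 : ‖((∫ θ, ‖h θ‖ ^ 2 / (‖h θ‖ + 1) ∂unitMeasure : ℝ) : ℂ)‖ ≤
      2 * (‖D‖ * Real.exp 1 ^ 2) := by
    rw [hsum]
    refine (norm_add_le _ _).trans ?_
    rw [norm_mul, Complex.norm_I, one_mul, two_mul]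
    exact add_le_add k1 k2
  rw [Complex.norm_real] at h4
  have h5 := (le_abs_self _).trans h4
  calc ∫ θ, ‖h θ‖ ∂unitMeasure ≤ ∫ θ, (‖h θ‖ ^ 2 / (‖h θ‖ + 1) + 1) ∂unitMeasure := by
        refine integral_mono (Continuous.integrable_unitMeasure (by fun_prop))
          (Continuous.integrable_unitMeasure (by fun_prop)) fun θ => ?_
        have : ‖h θ‖ ^ 2 / (‖h θ‖ + 1) + 1 - ‖h θ‖ = 1 / (‖h θ‖ + 1) := by
          field_simp [hpos θ]; ring
        have h6 : 0 ≤ 1 / (‖h θ‖ + 1) := by positivity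
        show ‖h θ‖ ≤ ‖h θ‖ ^ 2 / (‖h θ‖ + 1) + 1
        linarith
    _ ≤ _ := by
        rw [integral_add hc3.integrable_unitMeasure (integrable_const _)]
        simpa using h5

theorem IsDerivation.tendsto_integral_mul_conj_symbolPoly {D : ↥discAlgebra →L[ℂ] DADual}
    (hD : IsDerivation D) (J : ℂ[X]) :
    Tendsto (fun n => ∫ θ, J.eval (circlePoint θ) *
      (starRingEnd ℂ) ((symbolPoly D n).eval (circlePoint θ)) ∂unitMeasure) atTop
      (𝓝 (D (polyToDisc J) 1)) := by
  induction J using Polynomial.induction_on' with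
  | add p q hp hq =>
    convert hp.add hq using 1
    · ext n
      rw [← integral_add (Continuous.integrable_unitMeasure (by fun_prop))
        (Continuous.integrable_unitMeasure (by fun_prop))]
      simp [add_mul]
    · simp
  | monomial k a =>
    set b : ℕ → ℂ := fun m => D (polyToDisc (X ^ m)) 1 with hb
    have hb0 : b 0 = 0 := by simp [hb, hD.apply_one]
    have hu : Tendsto (fun j => ∑ m ∈ Finset.range j, a * (if k = m + 1 then b (m + 1) else 0))
        atTop (𝓝 (a * b k)) := by
      refine tendsto_const_nhds.congr' ?_
      filter_upwards [eventually_ge_atTop k] with j hj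
      rcases k with _ | k
      · simp [hb0]
      · simp [Nat.lt_of_succ_le hj]
    convert hu.cesaro_smul using 1
    · ext n
      simp only [symbolPoly, eval_cesaroPoly, map_sum, Finset.mul_sum]
      rw [integral_finsetSum _ fun i _ => Continuous.integrable_unitMeasure (by fun_prop),
        Finset.smul_sum]
      refine Finset.sum_congr rfl fun j _ => ?_
      rw [integral_finsetSum _ fun i _ => Continuous.integrable_unitMeasure (by fun_prop),
        Finset.smul_sum]
      refine Finset.sum_congr rfl fun m _ => ?_
      have h1 := integral_circlePoint_pow_mul_conj_pow k (m + 1)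
      have h2 : ∀ θ, (monomial k a).eval (circlePoint θ) * (starRingEnd ℂ)
          ((n : ℂ)⁻¹ * (starRingEnd ℂ) (b (m + 1)) * circlePoint θ ^ (m + 1)) =
          ((n : ℂ)⁻¹ * a * b (m + 1)) *
            (circlePoint θ ^ k * (starRingEnd ℂ) (circlePoint θ) ^ (m + 1)) := by
        intro θ
        rw [eval_monomial, map_mul, map_mul, map_pow, Complex.conj_conj, map_inv₀,
          Complex.conj_natCast]
        ring
      simp only [hb] at h2 ⊢
      simp_rw [h2]
      rw [integral_const_mul, h1, Complex.real_smul]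
      push_cast
      split_ifs <;> ring
    · rw [← Polynomial.C_mul_X_pow_eq_monomial, ← Polynomial.smul_eq_C_mul, map_smul, map_smul]
      rfl

/-- A bounded sequence of positive functionals on `C(X, ℝ)` with `X` compact converges along an
ultrafilter to integration against a finite measure. -/
theorem exists_measure_tendsto_of_bounded {X : Type*} [TopologicalSpace X] [CompactSpace X]
    [T2Space X] [MeasurableSpace X] [BorelSpace X] (L : ℕ → C(X, ℝ) →ₗ[ℝ] ℝ)
    (hpos : ∀ n k, 0 ≤ k → 0 ≤ L n k) {C : ℝ} (hC : ∀ n, L n 1 ≤ C) (U : Ultrafilter ℕ) :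
    ∃ μ : Measure X, IsFiniteMeasure μ ∧
      ∀ k : C(X, ℝ), Tendsto (fun n => L n k) U (𝓝 (∫ x, k x ∂μ)) := by
  have hmono : ∀ n (k₁ k₂ : C(X, ℝ)), k₁ ≤ k₂ → L n k₁ ≤ L n k₂ := by
    intro n k₁ k₂ h
    have := hpos n (k₂ - k₁) (sub_nonneg.mpr h)
    rwa [map_sub, sub_nonneg] at this
  have hbd : ∀ n (k : C(X, ℝ)), L n k ∈ Set.Icc (-(‖k‖ * C)) (‖k‖ * C) := by
    intro n k
    have h1 : L n (‖k‖ • 1) ≤ ‖k‖ * C := by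
      rw [map_smul, smul_eq_mul]
      exact mul_le_mul_of_nonneg_left (hC n) (norm_nonneg k)
    have h2 : k ≤ ‖k‖ • 1 := fun x => by
      simpa using (le_abs_self _).trans (k.norm_coe_le_norm x)
    have h3 : -(‖k‖ • 1) ≤ k := fun x => by
      simpa using (abs_le.mp (k.norm_coe_le_norm x)).1
    have h4 := hmono n _ _ h2
    have h5 := hmono n _ _ h3
    rw [map_neg] at h5
    exact ⟨by linarith, by linarith⟩
  have hlim : ∀ k : C(X, ℝ), ∃ l : ℝ, Tendsto (fun n => L n k) U (𝓝 l) := by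
    intro k
    obtain ⟨l, -, hl⟩ := isCompact_Icc.ultrafilter_le_nhds (U.map fun n => L n k)
      (le_principal_iff.mpr (Filter.mem_map.mpr (Filter.univ_mem' fun n => hbd n k)))
    exact ⟨l, hl⟩
  choose l hl using hlim
  let Λ : CompactlySupportedContinuousMap X ℝ →ₗ[ℝ] ℝ :=
    { toFun := fun k => l k
      map_add' := fun k₁ k₂ => tendsto_nhds_unique (hl _) <| by
        have := (hl k₁).add (hl k₂)
        simp only [← map_add] at this
        exact this
      map_smul' := fun c k => tendsto_nhds_unique (hl _) <| by
        have := (hl k).const_mul c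
        simp only [← smul_eq_mul, ← map_smul] at this
        exact this }
  let Λp : CompactlySupportedContinuousMap X ℝ →ₚ[ℝ] ℝ :=
    PositiveLinearMap.mk₀ Λ fun k hk =>
      ge_of_tendsto' (hl k) fun n => hpos n _ hk
  refine ⟨RealRMK.rieszMeasure Λp, inferInstance, fun k => ?_⟩
  have := RealRMK.integral_rieszMeasure Λp (CompactlySupportedContinuousMap.continuousMapEquiv k)
  have e : ∫ x, k x ∂(RealRMK.rieszMeasure Λp) = l k := this
  rw [e]
  exact hl k

/-- The radial retraction of the plane onto the closed unit disc. -/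
def discRetraction (z : ℂ) : closedDisc :=
  ⟨z / (max 1 ‖z‖ : ℝ), by
    have : 0 < max 1 ‖z‖ := lt_max_of_lt_left one_pos
    rw [mem_closedBall_zero_iff, norm_div, Complex.norm_real, Real.norm_of_nonneg this.le,
      div_le_one this]
    exact le_max_right _ _⟩

theorem continuous_discRetraction : Continuous discRetraction := by
  refine Continuous.subtype_mk (Continuous.div (by fun_prop) (by fun_prop) fun z => ?_) _
  exact Complex.ofReal_ne_zero.mpr (lt_max_of_lt_left one_pos).ne'

theorem discRetraction_of_norm_le {z : ℂ} (hz : ‖z‖ ≤ 1) : (discRetraction z : ℂ) = z := by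
  simp [discRetraction, hz]

/-- `carlesonFunctional` as a linear functional on continuous functions on the closed disc. -/
def carlesonLinearMap (G : ℂ[X]) : C(closedDisc, ℝ) →ₗ[ℝ] ℝ where
  toFun k := carlesonFunctional G fun z => k (discRetraction z)
  map_add' k₁ k₂ := carlesonFunctional_add G (k₁.continuous.comp continuous_discRetraction)
    (k₂.continuous.comp continuous_discRetraction)
  map_smul' c _ := carlesonFunctional_const_mul G c _

theorem carlesonLinearMap_nonneg (G : ℂ[X]) {k : C(closedDisc, ℝ)} (hk : 0 ≤ k) :
    0 ≤ carlesonLinearMap G k := by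
  have h := carlesonFunctional_mono G (k₁ := fun _ => 0 * 1) continuous_const
    (k.continuous.comp continuous_discRetraction) fun z => by simpa using hk (discRetraction z)
  rw [carlesonFunctional_const_mul, zero_mul] at h
  exact h

theorem exists_norm_polyToDisc_sub_le (f : ↥discAlgebra) {ε : ℝ} (hε : 0 < ε) :
    ∃ p : ℂ[X], ‖f - polyToDisc p‖ ≤ ε := by
  obtain ⟨F, hF, hfF⟩ := f.2
  have huc := CompactSpace.uniformContinuous_of_continuous (f : C(closedDisc, ℂ)).continuous
  rw [Metric.uniformContinuous_iff] at huc
  obtain ⟨δ, hδ, hd⟩ := huc (ε / 2) (by positivity)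
  obtain ⟨r, hr, hr1⟩ := exists_between (max_lt one_half_lt_one (sub_lt_self 1 hδ))
  have hr0 : 0 < r := by linarith [le_max_left (1 / 2) (1 - δ)]
  have hrδ : 1 - r < δ := by linarith [le_max_right (1 / 2) (1 - δ)]
  have hR : 1 < 1 / r := by rw [lt_div_iff₀ hr0]; linarith
  obtain ⟨p, hp⟩ := exists_polynomial_approx_of_differentiableOn (f := fun z => F (r * z)) hR
    (hF.comp (by fun_prop) fun z hz => by
      rw [mem_ball_zero_iff] at hz ⊢
      rw [norm_mul, Complex.norm_real, Real.norm_of_nonneg hr0.le]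
      rwa [lt_div_iff₀ hr0, mul_comm] at hz) (half_pos hε)
  refine ⟨p, discAlgebra_norm_le hε.le fun z => ?_⟩
  have hz : ‖(z : ℂ)‖ ≤ 1 := mem_closedBall_zero_iff.mp z.2
  have hrz : (r * z : ℂ) ∈ closedDisc := by
    rw [mem_closedBall_zero_iff, norm_mul, Complex.norm_real, Real.norm_of_nonneg hr0.le]
    nlinarith [norm_nonneg (z : ℂ)]
  have h1 := hp z hz
  have h2 := (@hd z ⟨r * z, hrz⟩ (by
    rw [Subtype.dist_eq, dist_eq_norm]
    have : (z : ℂ) - r * z = ((1 - r : ℝ) : ℂ) * z := by push_cast; ring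
    rw [this, norm_mul, Complex.norm_real, Real.norm_of_nonneg (by linarith)]
    nlinarith [norm_nonneg (z : ℂ)])).le
  rw [dist_eq_norm, hfF ⟨r * z, hrz⟩] at h2
  have e : ((f - polyToDisc p : ↥discAlgebra) : C(closedDisc, ℂ)) z =
      ((f : C(closedDisc, ℂ)) z - F (r * z)) + (F (r * z) - p.eval (z : ℂ)) := by
    rw [Subalgebra.coe_sub, ContinuousMap.sub_apply, polyToDisc_apply]; ring
  rw [e]
  exact (norm_add_le _ _).trans (by linarith)

theorem denseRange_polyToDisc : DenseRange polyToDisc := by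
  intro f
  rw [Metric.mem_closure_iff]
  intro ε hε
  obtain ⟨p, hp⟩ := exists_norm_polyToDisc_sub_le f (half_pos hε)
  exact ⟨polyToDisc p, ⟨p, rfl⟩, by rw [dist_eq_norm]; linarith⟩

theorem IsDerivation.exists_tendsto_integral_mul_conj {D : ↥discAlgebra →L[ℂ] DADual}
    (hD : IsDerivation D) :
    ∃ (M : ℝ) (G K : ℕ → ℂ[X]), 0 < M ∧
      (∀ n, ∫ θ, ‖(G n).eval (circlePoint θ)‖ ^ 2 ∂unitMeasure ≤ M) ∧
      (∀ n, ∫ θ, ‖(K n).eval (circlePoint θ)‖ ^ 2 ∂unitMeasure ≤ M) ∧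
      ∀ J : ℂ[X], Tendsto (fun n => ∫ θ, J.eval (circlePoint θ) *
        (starRingEnd ℂ) ((G n * K n).eval (circlePoint θ)) ∂unitMeasure) atTop
        (𝓝 (D (polyToDisc J) 1)) := by
  choose G K hG hK hGK using fun n : ℕ =>
    exists_approx_factorization (symbolPoly D (n + 1)) (Nat.one_div_pos_of_nat (α := ℝ) (n := n))
  have hb : ∀ n : ℕ, (2 * Real.exp 1 + 2) *
      (∫ θ, ‖(symbolPoly D (n + 1)).eval (circlePoint θ)‖ ∂unitMeasure + 1) ≤
      (2 * Real.exp 1 + 2) * (2 * (‖D‖ * Real.exp 1 ^ 2) + 1 + 1) := fun n => by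
    have := hD.integral_norm_symbolPoly_le n.succ_pos
    gcongr
  refine ⟨_, G, K, by positivity, fun n => (hG n).trans (hb n), fun n => (hK n).trans (hb n),
    fun J => ?_⟩
  have h1 := (tendsto_add_atTop_iff_nat 1).mpr (hD.tendsto_integral_mul_conj_symbolPoly J)
  have hbound : Tendsto (fun n : ℕ => (∫ θ, ‖J.eval (circlePoint θ)‖ ∂unitMeasure) *
      (1 / ((n : ℝ) + 1))) atTop (𝓝 0) := by
    simpa using (tendsto_one_div_add_atTop_nhds_zero_nat (𝕜 := ℝ)).const_mul
      (∫ θ, ‖J.eval (circlePoint θ)‖ ∂unitMeasure)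
  have h2 := squeeze_zero_norm (f := fun n : ℕ => (∫ θ, J.eval (circlePoint θ) *
      (starRingEnd ℂ) ((G n * K n).eval (circlePoint θ)) ∂unitMeasure) -
      ∫ θ, J.eval (circlePoint θ) *
      (starRingEnd ℂ) ((symbolPoly D (n + 1)).eval (circlePoint θ)) ∂unitMeasure)
    (fun n => ?_) hbound
  · simpa using h2.add h1
  · rw [← integral_sub (Continuous.integrable_unitMeasure (by fun_prop))
      (Continuous.integrable_unitMeasure (by fun_prop)), ← integral_mul_const]
    refine (norm_integral_le_integral_norm _).trans (integral_mono
      (Continuous.integrable_unitMeasure (by fun_prop))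
      (Continuous.integrable_unitMeasure (by fun_prop)) fun θ => ?_)
    show ‖_‖ ≤ _
    rw [← mul_sub, ← map_sub, norm_mul, RCLike.norm_conj]
    exact mul_le_mul_of_nonneg_left (hGK n θ) (norm_nonneg _)

/-- The continuous function `|f|²` on the closed disc. -/
def normSqMap (f : ↥discAlgebra) : C(closedDisc, ℝ) :=
  ⟨fun z => ‖(f : C(closedDisc, ℂ)) z‖ ^ 2, by fun_prop⟩

theorem carlesonLinearMap_normSqMap (G f : ℂ[X]) :
    carlesonLinearMap G (normSqMap (polyToDisc f)) =
      carlesonFunctional G fun z => ‖f.eval z‖ ^ 2 := by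
  show carlesonFunctional G (fun z => normSqMap (polyToDisc f) (discRetraction z)) = _
  refine carlesonFunctional_congr G fun z hz => ?_
  show ‖(polyToDisc f : C(closedDisc, ℂ)) (discRetraction z)‖ ^ 2 = _
  rw [polyToDisc_apply, discRetraction_of_norm_le hz]

theorem sq_le_of_forall_le_mul_add {x M A : ℝ} (hx : 0 ≤ x) (hM : 0 < M) (hA : 0 ≤ A)
    (h : ∀ s : ℝ, 0 < s → x ≤ s * A + s⁻¹ * M) : x ^ 2 ≤ 4 * M * A := by
  rcases hx.eq_or_lt with rfl | hx
  · rw [zero_pow two_ne_zero]; positivity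
  · have h1 := h (2 * M / x) (by positivity)
    have h2 : (2 * M / x)⁻¹ * M = x / 2 := by field_simp
    rw [h2] at h1
    have h3 : x / 2 ≤ 2 * M / x * A := by linarith
    have h4 := mul_le_mul_of_nonneg_left h3 hx.le
    have h5 : x * (2 * M / x * A) = 2 * M * A := by field_simp
    nlinarith

theorem integral_normSqMap_nonneg (μ : Measure closedDisc) (f : ↥discAlgebra) :
    0 ≤ ∫ z, normSqMap f z ∂μ :=
  integral_nonneg fun _ => sq_nonneg _

theorem continuous_integral_normSqMap (μ : Measure closedDisc) [IsFiniteMeasure μ] :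
    Continuous fun f : ↥discAlgebra => ∫ z, normSqMap f z ∂μ := by
  have hn : Continuous normSqMap := by
    refine ContinuousMap.continuous_of_continuous_uncurry _ ?_
    show Continuous fun p : ↥discAlgebra × closedDisc => ‖(p.1 : C(closedDisc, ℂ)) p.2‖ ^ 2
    fun_prop
  have hint : ∀ k : C(closedDisc, ℝ), Integrable k μ := fun k =>
    k.continuous.integrable_of_hasCompactSupport (HasCompactSupport.of_compactSpace k)
  have hk : LipschitzWith (μ.real Set.univ).toNNReal fun k : C(closedDisc, ℝ) => ∫ z, k z ∂μ := by
    refine LipschitzWith.of_dist_le_mul fun k₁ k₂ => ?_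
    rw [Real.coe_toNNReal _ measureReal_nonneg, dist_eq_norm, dist_eq_norm,
      ← integral_sub (hint k₁) (hint k₂), mul_comm]
    exact norm_integral_le_of_norm_le_const (.of_forall fun z => (k₁ - k₂).norm_coe_le_norm z)
  exact hk.continuous.comp hn

theorem IsDerivation.exists_measure_norm_sq_le {D : ↥discAlgebra →L[ℂ] DADual}
    (hD : IsDerivation D) :
    ∃ (M : ℝ) (μ : Measure closedDisc), 0 < M ∧ IsFiniteMeasure μ ∧
      ∀ f g : ℂ[X], ‖D (polyToDisc f) (polyToDisc g)‖ ≤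
        Real.sqrt (M * ∫ z, normSqMap (polyToDisc f) z ∂μ) * ‖polyToDisc g‖ := by
  obtain ⟨M, G, K, hM, hG, hK, hlim⟩ := hD.exists_tendsto_integral_mul_conj
  obtain ⟨μ, hμ, hμL⟩ := exists_measure_tendsto_of_bounded
    (fun n => carlesonLinearMap (G n) + carlesonLinearMap (K n))
    (fun n k hk => add_nonneg (carlesonLinearMap_nonneg _ hk) (carlesonLinearMap_nonneg _ hk))
    (C := 2 * M + 2 * M)
    (fun n => add_le_add
      ((carlesonFunctional_one_le (G n)).trans (by linarith [hG n]))
      ((carlesonFunctional_one_le (K n)).trans (by linarith [hK n]))) (Ultrafilter.of atTop)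
  refine ⟨4 * M, μ, by positivity, hμ, fun f g => ?_⟩
  obtain ⟨J, hJ, hJ0⟩ := exists_derivative_eq (derivative f * g)
  have hDJ : D (polyToDisc f) (polyToDisc g) = D (polyToDisc J) 1 := by
    rw [hD.apply_polyToDisc f, hD.apply_polyToDisc J, hJ, mul_one, map_mul polyToDisc]
  rw [hDJ]
  have hg : ∀ z : ℂ, ‖z‖ ≤ 1 → ‖g.eval z‖ ≤ ‖polyToDisc g‖ := fun z hz => by
    have := discAlgebra_norm_apply_le (polyToDisc g) ⟨z, mem_closedBall_zero_iff.mpr hz⟩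
    rwa [polyToDisc_apply] at this
  have key : ∀ s : ℝ, 0 < s → ‖D (polyToDisc J) 1‖ ≤ ‖polyToDisc g‖ *
      (s * (∫ z, normSqMap (polyToDisc f) z ∂μ) + s⁻¹ * M) := by
    intro s hs
    have h1 := ((hlim J).mono_left (Ultrafilter.of_le atTop)).norm
    have h2 := (((hμL (normSqMap (polyToDisc f))).const_mul s).add_const (s⁻¹ * M)).const_mul
      ‖polyToDisc g‖
    refine le_of_tendsto_of_tendsto' h1 h2 fun n => ?_
    rw [LinearMap.add_apply, carlesonLinearMap_normSqMap, carlesonLinearMap_normSqMap]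
    exact norm_integral_mul_conj_le hJ hJ0 (norm_nonneg _) hg (hG n) (hK n) hs
  rcases (norm_nonneg (polyToDisc g)).eq_or_lt with h0 | h0
  · have := key 1 one_pos
    rw [← h0, zero_mul] at this
    rw [← h0, mul_zero]
    exact this
  · rw [← div_le_iff₀ h0]
    refine Real.le_sqrt_of_sq_le (sq_le_of_forall_le_mul_add (by positivity) hM
      (integral_normSqMap_nonneg μ _) fun s hs => ?_)
    rw [div_le_iff₀ h0, mul_comm]
    exact key s hs

/-- (Pietsch control measure.)  For every bounded derivation `D` from the
disc algebra to its dual there is a finite positive Borel measure `μ` on the closed unit disc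
with `‖D(f)‖ ≤ (∫_Δ |f|² dμ)^{1/2}` for all `f ∈ A(𝔻)`. -/
theorem exists_pietsch_measure
    (D : ↥discAlgebra →L[ℂ] DADual) (hD : IsDerivation D) :
    ∃ μ : Measure closedDisc, IsFiniteMeasure μ ∧
      ∀ f : ↥discAlgebra,
        ‖D f‖ ≤ Real.sqrt (∫ z, ‖(f : C(closedDisc, ℂ)) z‖ ^ 2 ∂μ) := by
  obtain ⟨M, μ, hM, hμ, h⟩ := hD.exists_measure_norm_sq_le
  refine ⟨ENNReal.ofReal M • μ, μ.smul_finite ENNReal.ofReal_ne_top, fun f => ?_⟩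
  rw [integral_smul_measure, ENNReal.toReal_ofReal hM.le, smul_eq_mul]
  have hcont := continuous_integral_normSqMap μ
  refine denseRange_polyToDisc.induction_on f
    (isClosed_le (by fun_prop) (Continuous.sqrt (continuous_const.mul hcont))) fun p => ?_
  refine ContinuousLinearMap.opNorm_le_bound _ (Real.sqrt_nonneg _) fun g => ?_
  refine denseRange_polyToDisc.induction_on g (isClosed_le (by fun_prop) (by fun_prop))
    fun q => ?_
  exact h p q

end
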